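/- arXiv:2202.03361 — 3 statements merged into one kernel-verified Lean document; each statement's English description precedes it below -/
import Mathlib

section
/- For all integers k and k', every positive integer ℓ, and every function c : ℤ × ℤ → ℂ, the weight-k formal Hecke operator decomposes into weight-k' formal Hecke operators: T_{k,ℓ} c = Σ_{e·d = ℓ} c_{k,k'}(e) · B_e (T_{k',d} c), where the sum runs over all factorizations of ℓ into positive integers e and d. -/
/-- The `ℓ`-th formal Hecke operator of weight `k`, acting on functions
`c : ℤ × ℤ → ℂ` (the Fourier coefficients of a series `∑ c(n,r) qⁿ pʳ`):
`(T_{k,ℓ} c)(n,r) = ∑_{a | (ℓ,n,r)} a^{k-1} c(ℓn/a², r/a)`. -/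
noncomputable def heckeT (k : ℤ) (ℓ : ℕ) (c : ℤ × ℤ → ℂ) : ℤ × ℤ → ℂ :=
  fun nr =>
    ∑ a ∈ ℓ.divisors.filter (fun a : ℕ => (a : ℤ) ∣ nr.1 ∧ (a : ℤ) ∣ nr.2),
      (a : ℂ) ^ (k - 1) * c ((ℓ : ℤ) * nr.1 / (a : ℤ) ^ 2, nr.2 / (a : ℤ))

/-- The scaling operator `B_e`: `(B_e c)(n,r) = c(n/e, r/e)` if `e ∣ n` and `e ∣ r`,
and `0` otherwise. -/
noncomputable def opB (e : ℕ) (c : ℤ × ℤ → ℂ) : ℤ × ℤ → ℂ :=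
  fun nr => if (e : ℤ) ∣ nr.1 ∧ (e : ℤ) ∣ nr.2 then c (nr.1 / (e : ℤ), nr.2 / (e : ℤ)) else 0

/-- The arithmetic constant `c_{k,k'}(e) = ∑_{a·b=e} a^{k-1} b^{k'-1} μ(b)`. -/
noncomputable def cConst (k k' : ℤ) (e : ℕ) : ℂ :=
  ∑ a ∈ e.divisors,
    (a : ℂ) ^ (k - 1) * ((e / a : ℕ) : ℂ) ^ (k' - 1) *
      ((ArithmeticFunction.moebius (e / a) : ℤ) : ℂ)

/-- The arithmetic function `n ↦ n ^ k`, with an integer exponent, set to `0` at `0`. -/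
noncomputable def zpowArith (k : ℤ) : ArithmeticFunction ℂ :=
  ⟨fun n => if n = 0 then 0 else (n : ℂ) ^ k, if_pos rfl⟩

theorem zpowArith_apply (k : ℤ) {n : ℕ} (hn : n ≠ 0) : zpowArith k n = (n : ℂ) ^ k :=
  if_neg hn

theorem pmul_moebius_mul_zpowArith (k : ℤ) :
    (zpowArith k).pmul ((ArithmeticFunction.moebius : ArithmeticFunction ℤ) :
      ArithmeticFunction ℂ) * zpowArith k = 1 := by
  ext n
  have h := congrArg (fun f : ArithmeticFunction ℂ => zpowArith k n * f n)
    (ArithmeticFunction.coe_moebius_mul_coe_zeta (R := ℂ))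
  simp only [ArithmeticFunction.mul_apply, Finset.mul_sum] at h
  have hone : zpowArith k n * (1 : ArithmeticFunction ℂ) n = (1 : ArithmeticFunction ℂ) n := by
    by_cases hn : n = 1
    · simp [hn, zpowArith_apply]
    · simp [ArithmeticFunction.one_apply_ne hn]
  rw [ArithmeticFunction.mul_apply, ← hone, ← h]
  refine Finset.sum_congr rfl fun x hx => ?_
  obtain ⟨rfl, hn⟩ := Nat.mem_divisorsAntidiagonal.mp hx
  obtain ⟨h1, h2⟩ := mul_ne_zero_iff.mp hn
  simp only [ArithmeticFunction.pmul_apply, zpowArith_apply k hn, zpowArith_apply k h1,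
    zpowArith_apply k h2, ArithmeticFunction.natCoe_apply, ArithmeticFunction.zeta_apply_ne h2,
    Nat.cast_mul, mul_zpow, Nat.cast_one]
  ring

theorem cConst_eq_mul_apply (k k' : ℤ) (e : ℕ) :
    cConst k k' e = (zpowArith (k - 1) * (zpowArith (k' - 1)).pmul
      ((ArithmeticFunction.moebius : ArithmeticFunction ℤ) : ArithmeticFunction ℂ)) e := by
  rw [ArithmeticFunction.mul_apply, cConst, Nat.sum_divisorsAntidiagonal
    (f := fun a b => zpowArith (k - 1) a * (zpowArith (k' - 1)).pmul
      ((ArithmeticFunction.moebius : ArithmeticFunction ℤ) : ArithmeticFunction ℂ) b)]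
  refine Finset.sum_congr rfl fun a ha => ?_
  obtain ⟨⟨b, rfl⟩, hn⟩ := Nat.mem_divisors.mp ha
  obtain ⟨h1, h2⟩ := mul_ne_zero_iff.mp hn
  rw [Nat.mul_div_cancel_left b (Nat.pos_of_ne_zero h1), ArithmeticFunction.pmul_apply,
    zpowArith_apply _ h1, zpowArith_apply _ h2, ArithmeticFunction.intCoe_apply, mul_assoc]

theorem sum_cConst_mul_zpow (k k' : ℤ) {m : ℕ} (hm : m ≠ 0) :
    ∑ e ∈ m.divisors, cConst k k' e * ((m / e : ℕ) : ℂ) ^ (k' - 1) = (m : ℂ) ^ (k - 1) := by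
  rw [← zpowArith_apply _ hm, ← mul_one (zpowArith (k - 1)),
    ← pmul_moebius_mul_zpowArith (k' - 1), ← mul_assoc, ArithmeticFunction.mul_apply,
    Nat.sum_divisorsAntidiagonal (f := fun a b => (zpowArith (k - 1) * (zpowArith (k' - 1)).pmul
      ((ArithmeticFunction.moebius : ArithmeticFunction ℤ) : ArithmeticFunction ℂ)) a *
      zpowArith (k' - 1) b)]
  refine Finset.sum_congr rfl fun e he => ?_
  have h2 : m / e ≠ 0 := (Nat.div_pos (Nat.divisor_le he) (Nat.pos_of_mem_divisors he)).ne'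
  rw [cConst_eq_mul_apply, zpowArith_apply _ h2]

theorem Nat.sum_divisors_sum_divisors_div {M : Type*} [AddCommMonoid M] (n : ℕ)
    (f : ℕ → ℕ → M) :
    ∑ e ∈ n.divisors, ∑ a ∈ (n / e).divisors, f e a =
      ∑ m ∈ n.divisors, ∑ e ∈ m.divisors, f e (m / e) := by
  rw [Finset.sum_sigma', Finset.sum_sigma']
  refine Finset.sum_bij' (fun x _ => ⟨x.1 * x.2, x.1⟩) (fun x _ => ⟨x.2, x.1 / x.2⟩) ?_ ?_ ?_ ?_ ?_
  · rintro ⟨e, a⟩ h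
    simp only [Finset.mem_sigma, Nat.mem_divisors] at h ⊢
    obtain ⟨⟨he, hn⟩, ha, hne⟩ := h
    have hd : e * a ∣ n := Nat.mul_dvd_of_dvd_div he ha
    exact ⟨⟨hd, hn⟩, dvd_mul_right e a, ne_zero_of_dvd_ne_zero hn hd⟩
  · rintro ⟨m, e⟩ h
    simp only [Finset.mem_sigma, Nat.mem_divisors] at h ⊢
    obtain ⟨⟨hm, hn⟩, he, hm0⟩ := h
    have hen := he.trans hm
    exact ⟨⟨hen, hn⟩, Nat.div_dvd_div he hm,
      (Nat.div_pos (Nat.le_of_dvd (Nat.pos_of_ne_zero hn) hen)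
        (Nat.pos_of_dvd_of_pos hen (Nat.pos_of_ne_zero hn))).ne'⟩
  · rintro ⟨e, a⟩ h
    have he := Nat.pos_of_mem_divisors (Finset.mem_sigma.mp h).1
    simp [Nat.mul_div_cancel_left a he]
  · rintro ⟨m, e⟩ h
    have he := Nat.dvd_of_mem_divisors (Finset.mem_sigma.mp h).2
    simp [Nat.mul_div_cancel' he]
  · rintro ⟨e, a⟩ h
    have he := Nat.pos_of_mem_divisors (Finset.mem_sigma.mp h).1
    simp [Nat.mul_div_cancel_left a he]

/-- The coefficient `c(ℓn/m², r/m)`, extended by `0` when `m` does not divide both `n` and `r`. -/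
noncomputable def heckeCoeff (ℓ : ℕ) (c : ℤ × ℤ → ℂ) (nr : ℤ × ℤ) (m : ℕ) : ℂ :=
  if (m : ℤ) ∣ nr.1 ∧ (m : ℤ) ∣ nr.2 then
    c ((ℓ : ℤ) * nr.1 / (m : ℤ) ^ 2, nr.2 / (m : ℤ)) else 0

theorem heckeT_apply (k : ℤ) (ℓ : ℕ) (c : ℤ × ℤ → ℂ) (nr : ℤ × ℤ) :
    heckeT k ℓ c nr = ∑ a ∈ ℓ.divisors, (a : ℂ) ^ (k - 1) * heckeCoeff ℓ c nr a := by
  simp only [heckeT, heckeCoeff, Finset.sum_filter, mul_ite, mul_zero]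

theorem opB_heckeT_apply (k : ℤ) {ℓ e : ℕ} (he : e ∈ ℓ.divisors) (c : ℤ × ℤ → ℂ) (nr : ℤ × ℤ) :
    opB e (heckeT k (ℓ / e) c) nr =
      ∑ a ∈ (ℓ / e).divisors, (a : ℂ) ^ (k - 1) * heckeCoeff ℓ c nr (e * a) := by
  have he0 : (e : ℤ) ≠ 0 := by exact_mod_cast (Nat.pos_of_mem_divisors he).ne'
  obtain ⟨n, r⟩ := nr
  unfold opB
  split_ifs with h
  · obtain ⟨⟨n, rfl⟩, r, rfl⟩ := h
    obtain ⟨⟨d, rfl⟩, -⟩ := Nat.mem_divisors.mp he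
    rw [heckeT_apply]
    refine Finset.sum_congr rfl fun a _ => ?_
    rw [Nat.mul_div_cancel_left d (Nat.pos_of_mem_divisors he)]
    simp only [heckeCoeff, Nat.cast_mul, Int.mul_ediv_cancel_left _ he0, mul_dvd_mul_iff_left he0,
      Int.mul_ediv_mul_of_pos _ _ (Int.natCast_pos.mpr (Nat.pos_of_mem_divisors he))]
    rw [show (e : ℤ) * d * (e * n) = e ^ 2 * (d * n) by ring, mul_pow,
      Int.mul_ediv_mul_of_pos _ _ (by positivity)]
  · refine (Finset.sum_eq_zero fun a _ => ?_).symm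
    rw [heckeCoeff, if_neg, mul_zero]
    rw [Nat.cast_mul]
    exact fun h' => h ⟨dvd_of_mul_right_dvd h'.1, dvd_of_mul_right_dvd h'.2⟩

/-- The weight-`k` formal Hecke operator decomposes into weight-`k'` formal Hecke
operators: `T_{k,ℓ} = ∑_{e·d = ℓ} c_{k,k'}(e) · B_e ∘ T_{k',d}`. -/
theorem heckeT_eq_sum_cConst_opB_heckeT (k k' : ℤ) (ℓ : ℕ) (hℓ : 0 < ℓ) (c : ℤ × ℤ → ℂ) :
    heckeT k ℓ c = fun nr =>
      ∑ e ∈ ℓ.divisors, cConst k k' e * opB e (heckeT k' (ℓ / e) c) nr := by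
  funext nr
  rw [heckeT_apply]
  have hB : ∀ e ∈ ℓ.divisors, cConst k k' e * opB e (heckeT k' (ℓ / e) c) nr =
      ∑ a ∈ (ℓ / e).divisors,
        cConst k k' e * (a : ℂ) ^ (k' - 1) * heckeCoeff ℓ c nr (e * a) := fun e he => by
    simp only [opB_heckeT_apply k' he, Finset.mul_sum, mul_assoc]
  rw [Finset.sum_congr rfl hB, Nat.sum_divisors_sum_divisors_div ℓ
    fun e a => cConst k k' e * (a : ℂ) ^ (k' - 1) * heckeCoeff ℓ c nr (e * a)]
  refine Finset.sum_congr rfl fun m hm => ?_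
  rw [← sum_cConst_mul_zpow k k' (Nat.pos_of_mem_divisors hm).ne', Finset.sum_mul]
  refine Finset.sum_congr rfl fun e he => ?_
  rw [Nat.mul_div_cancel' (Nat.dvd_of_mem_divisors he)]
end

section
/- Let m ∈ ℤ and let f : ℂ × ℍ → ℂ admit an absolutely convergent Fourier expansion f(x,τ) = Σ_{n≥0} Σ_{r∈ℤ} c(n,r) e(nτ + rx) for all (x,τ) ∈ ℂ × ℍ, where c : ℤ × ℤ → ℂ satisfies c(n,r) = 0 for n < 0. If f satisfies the index-m elliptic transformation law f(x + λτ + μ, τ) = e(−mλ²τ − 2λmx)·f(x,τ) for all λ, μ ∈ ℤ, then the Fourier coefficients satisfy c(n − λr + mλ², r − 2λm) = c(n,r) for all n, r, λ ∈ ℤ. -/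
/-- `e(w) = exp(2πi w)`. -/
noncomputable def eC (w : ℂ) : ℂ := Complex.exp (2 * (Real.pi : ℂ) * Complex.I * w)

theorem eC_add (a b : ℂ) : eC (a + b) = eC a * eC b := by
  simp only [eC, mul_add, Complex.exp_add]

theorem eC_zero : eC 0 = 1 := by simp [eC]

theorem eC_ne_zero (a : ℂ) : eC a ≠ 0 := Complex.exp_ne_zero _

theorem eC_intCast (n : ℤ) : eC (n : ℂ) = 1 :=
  Complex.exp_eq_one_iff.2 ⟨n, by ring⟩

theorem norm_eC_ofReal (t : ℝ) : ‖eC (t : ℂ)‖ = 1 := by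
  rw [eC, show 2 * (Real.pi : ℂ) * Complex.I * t = ((2 * Real.pi * t : ℝ) : ℂ) * Complex.I by
    push_cast; ring]
  exact Complex.norm_exp_ofReal_mul_I _

theorem norm_eC_int_mul_ofReal (n : ℤ) (t : ℝ) : ‖eC ((n : ℂ) * (t : ℂ))‖ = 1 := by
  have := norm_eC_ofReal ((n : ℝ) * t)
  push_cast at this
  exact this

theorem continuous_eC : Continuous eC := by
  unfold eC
  fun_prop

theorem integral_eC_int_mul (n : ℤ) :
    ∫ t in (0 : ℝ)..1, eC ((n : ℂ) * (t : ℂ)) = if n = 0 then 1 else 0 := by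
  split_ifs with h
  · simp [h, eC_zero]
  · have hn : 2 * (Real.pi : ℂ) * Complex.I * n ≠ 0 := by
      simp [h, Real.pi_ne_zero]
    have key := integral_exp_mul_complex (a := 0) (b := 1) hn
    have h1 : Complex.exp (2 * (Real.pi : ℂ) * Complex.I * n) = 1 := eC_intCast n
    simp only [Complex.ofReal_one, mul_one, Complex.ofReal_zero, mul_zero, Complex.exp_zero, h1,
      sub_self, zero_div] at key
    rw [← key]
    simp only [eC, mul_assoc]

/-- The coefficients of an absolutely convergent Fourier series that vanishes identically on the
real line are zero. -/
theorem eq_zero_of_tsum_mul_eC_eq_zero {a : ℤ → ℂ} (ha : Summable fun n => ‖a n‖)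
    (h : ∀ t : ℝ, ∑' n, a n * eC ((n : ℂ) * (t : ℂ)) = 0) (k : ℤ) : a k = 0 := by
  have hcont (n : ℤ) : Continuous fun t : ℝ => a n * eC (((n - k : ℤ) : ℂ) * (t : ℂ)) :=
    continuous_const.mul (continuous_eC.comp (by fun_prop))
  have hs := intervalIntegral.hasSum_intervalIntegral_of_summable_norm (a := 0) (b := 1)
    (f := fun n : ℤ => (⟨_, hcont n⟩ : C(ℝ, ℂ))) (by
      refine Summable.of_nonneg_of_le (fun _ => norm_nonneg _) (fun n => ?_) ha
      refine (ContinuousMap.norm_le _ (norm_nonneg _)).2 fun t => ?_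
      simp [ContinuousMap.restrict_apply, norm_eC_int_mul_ofReal, -Int.cast_sub])
  have hz (t : ℝ) : ∑' n, a n * eC (((n - k : ℤ) : ℂ) * (t : ℂ)) = 0 := by
    have hfac (n : ℤ) : a n * eC (((n - k : ℤ) : ℂ) * (t : ℂ)) =
        a n * eC ((n : ℂ) * (t : ℂ)) * eC (-(k : ℂ) * (t : ℂ)) := by
      rw [mul_assoc, ← eC_add]
      push_cast
      ring_nf
    simp_rw [hfac, tsum_mul_right, h t, zero_mul]
  simp only [ContinuousMap.coe_mk, hz, intervalIntegral.integral_zero,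
    intervalIntegral.integral_const_mul, integral_eC_int_mul, sub_eq_zero] at hs
  have hk : HasSum (fun n : ℤ => a n * if n = k then 1 else 0) (a k) := by
    convert hasSum_single k ?_ using 1
    · simp
    · intro n hn
      simp [hn]
  exact hk.unique hs

/-- Two-variable version of `eq_zero_of_tsum_mul_eC_eq_zero`. -/
theorem eq_zero_of_tsum_prod_mul_eC_eq_zero {a : ℤ × ℤ → ℂ} (ha : Summable fun p => ‖a p‖)
    (h : ∀ t s : ℝ, ∑' p : ℤ × ℤ, a p * eC ((p.1 : ℂ) * (t : ℂ) + (p.2 : ℂ) * (s : ℂ)) = 0)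
    (p : ℤ × ℤ) : a p = 0 := by
  have hsummable (t s : ℝ) : Summable fun p : ℤ × ℤ =>
      ‖a p * eC ((p.1 : ℂ) * (t : ℂ) + (p.2 : ℂ) * (s : ℂ))‖ := by
    simpa [eC_add, norm_eC_int_mul_ofReal] using ha
  have hfac (t s : ℝ) (n r : ℤ) : a (n, r) * eC ((n : ℂ) * (t : ℂ) + (r : ℂ) * (s : ℂ)) =
      a (n, r) * eC ((r : ℂ) * (s : ℂ)) * eC ((n : ℂ) * (t : ℂ)) := by
    rw [eC_add]
    ring
  have hnorm (s : ℝ) (n r : ℤ) : ‖a (n, r) * eC ((r : ℂ) * (s : ℂ))‖ = ‖a (n, r)‖ := by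
    simp [norm_eC_int_mul_ofReal]
  refine eq_zero_of_tsum_mul_eC_eq_zero (a := fun r => a (p.1, r)) (ha.prod_factor p.1)
    (fun s => ?_) p.2
  refine eq_zero_of_tsum_mul_eC_eq_zero
    (a := fun n => ∑' r, a (n, r) * eC ((r : ℂ) * (s : ℂ))) ?_ (fun t => ?_) p.1
  · refine Summable.of_nonneg_of_le (fun _ => norm_nonneg _) (fun n => ?_) ha.prod
    have hn : Summable fun r => ‖a (n, r) * eC ((r : ℂ) * (s : ℂ))‖ := by
      simpa only [hnorm] using ha.prod_factor n
    simpa only [hnorm] using norm_tsum_le_tsum_norm hn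
  · rw [← h t s, (hsummable t s).of_norm.tsum_prod]
    simp_rw [hfac, tsum_mul_right]

/-- The substitution of Fourier indices induced by the translation `x ↦ x + l * τ` in index `m`. -/
def ellipticIndexEquiv (m l : ℤ) : ℤ × ℤ ≃ ℤ × ℤ where
  toFun p := (p.1 - l * p.2 + m * l ^ 2, p.2 - 2 * l * m)
  invFun p := (p.1 + l * p.2 + m * l ^ 2, p.2 + 2 * l * m)
  left_inv p := by ext <;> simp; ring
  right_inv p := by ext <;> simp; ring


/-- Suppose `f : ℂ × ℍ → ℂ` (a function of two complex variables constrained only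
for `τ` in the upper half-plane) has an absolutely convergent Fourier expansion
`f(x,τ) = ∑_{n≥0, r∈ℤ} c(n,r) e(nτ + rx)`, with `c(n,r) = 0` for `n < 0`. If `f`
satisfies the index-`m` elliptic transformation law
`f(x + λτ + μ, τ) = e(-mλ²τ - 2λmx) f(x,τ)` for all `λ, μ ∈ ℤ`, then the Fourier
coefficients satisfy `c(n - λr + mλ², r - 2λm) = c(n,r)` for all `n, r, λ ∈ ℤ`. -/
theorem fourier_coeff_elliptic_symmetry (m : ℤ) (f : ℂ → ℂ → ℂ) (c : ℤ × ℤ → ℂ)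
    (hc0 : ∀ n r : ℤ, n < 0 → c (n, r) = 0)
    (habs : ∀ x τ : ℂ, 0 < τ.im →
      Summable (fun nr : ℤ × ℤ => ‖c nr * eC ((nr.1 : ℂ) * τ + (nr.2 : ℂ) * x)‖))
    (hsum : ∀ x τ : ℂ, 0 < τ.im →
      f x τ = ∑' nr : ℤ × ℤ, c nr * eC ((nr.1 : ℂ) * τ + (nr.2 : ℂ) * x))
    (hell : ∀ x τ : ℂ, 0 < τ.im → ∀ l μ : ℤ,
      f (x + (l : ℂ) * τ + (μ : ℂ)) τ =
        eC (-(m : ℂ) * (l : ℂ) ^ 2 * τ - 2 * (l : ℂ) * (m : ℂ) * x) * f x τ) :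
    ∀ n r l : ℤ, c (n - l * r + m * l ^ 2, r - 2 * l * m) = c (n, r) := by
  intro n r l
  have hterm (x τ : ℂ) (p : ℤ × ℤ) :
      c (ellipticIndexEquiv m l p) * eC ((p.1 : ℂ) * τ + (p.2 : ℂ) * x) =
        c (ellipticIndexEquiv m l p) * eC (((ellipticIndexEquiv m l p).1 : ℂ) * τ +
          ((ellipticIndexEquiv m l p).2 : ℂ) * (x + (l : ℂ) * τ + ((0 : ℤ) : ℂ))) *
          eC ((m : ℂ) * (l : ℂ) ^ 2 * τ + 2 * (l : ℂ) * (m : ℂ) * x) := by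
    rw [mul_assoc, ← eC_add]
    simp only [ellipticIndexEquiv, Equiv.coe_fn_mk]
    push_cast
    ring_nf
  have hshift (x τ : ℂ) (hτ : 0 < τ.im) :
      HasSum (fun p : ℤ × ℤ =>
        c (ellipticIndexEquiv m l p) * eC ((p.1 : ℂ) * τ + (p.2 : ℂ) * x)) (f x τ) := by
    have h0 := (habs (x + (l : ℂ) * τ + ((0 : ℤ) : ℂ)) τ hτ).of_norm.hasSum
    rw [← hsum _ _ hτ, hell _ _ hτ] at h0
    have h1 := ((ellipticIndexEquiv m l).hasSum_iff.2 h0).mul_right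
      (eC ((m : ℂ) * (l : ℂ) ^ 2 * τ + 2 * (l : ℂ) * (m : ℂ) * x))
    simp only [Function.comp_def, ← hterm] at h1
    have hcancel : eC (-(m : ℂ) * (l : ℂ) ^ 2 * τ - 2 * (l : ℂ) * (m : ℂ) * x) * f x τ *
        eC ((m : ℂ) * (l : ℂ) ^ 2 * τ + 2 * (l : ℂ) * (m : ℂ) * x) = f x τ := by
      rw [mul_right_comm, ← eC_add]
      ring_nf
      rw [eC_zero, one_mul]
    rwa [hcancel] at h1
  have hdiff (x τ : ℂ) (hτ : 0 < τ.im) : HasSum (fun p : ℤ × ℤ =>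
      (c (ellipticIndexEquiv m l p) - c p) * eC ((p.1 : ℂ) * τ + (p.2 : ℂ) * x)) 0 := by
    have h0 := (habs x τ hτ).of_norm.hasSum
    rw [← hsum _ _ hτ] at h0
    simpa only [sub_mul, sub_self] using (hshift x τ hτ).sub h0
  have hreal (t s : ℝ) (p : ℤ × ℤ) :
      (c (ellipticIndexEquiv m l p) - c p) *
          eC ((p.1 : ℂ) * (Complex.I + (t : ℂ)) + (p.2 : ℂ) * (s : ℂ)) =
        (c (ellipticIndexEquiv m l p) - c p) * eC ((p.1 : ℂ) * Complex.I) *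
          eC ((p.1 : ℂ) * (t : ℂ) + (p.2 : ℂ) * (s : ℂ)) := by
    rw [mul_assoc, ← eC_add]
    ring_nf
  have hzero := eq_zero_of_tsum_prod_mul_eC_eq_zero
    (a := fun p => (c (ellipticIndexEquiv m l p) - c p) * eC ((p.1 : ℂ) * Complex.I))
    (by simpa using (hdiff 0 Complex.I (by simp)).summable.norm)
    (fun t s => by
      simpa only [hreal] using (hdiff s (Complex.I + t) (by simp)).tsum_eq) (n, r)
  exact sub_eq_zero.1 ((mul_eq_zero.1 hzero).resolve_right (eC_ne_zero _))
end

section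
/- Let k, m ∈ ℤ, let ℓ be a positive integer, and let f : ℂ × ℍ → ℂ satisfy the index-m elliptic transformation law f(x + λτ + μ, τ) = e(−mλ²τ − 2λmx)·f(x,τ) for all λ, μ ∈ ℤ. Then the Hecke transform h(x,τ) := ℓ^{k−1} · Σ_{a·d = ℓ} Σ_{b=0}^{d−1} d^{−k} f(a·x, (aτ+b)/d) (sum over all factorizations of ℓ into positive integers a, d) satisfies the index-mℓ elliptic transformation law: h(x + λτ + μ, τ) = e(−mℓλ²τ − 2λmℓx)·h(x,τ) for all λ, μ ∈ ℤ. -/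
/-- A function `f : ℂ × ℍ → ℂ` (regarded as a function of two complex variables,
constrained only for `τ` in the upper half-plane) satisfies the index-`m` elliptic
transformation law: `f(x + λτ + μ, τ) = e(-mλ²τ - 2λmx) f(x,τ)` for all `λ, μ ∈ ℤ`. -/
def EllipticLaw (m : ℤ) (f : ℂ → ℂ → ℂ) : Prop :=
  ∀ x τ : ℂ, 0 < τ.im → ∀ l μ : ℤ,
    f (x + (l : ℂ) * τ + (μ : ℂ)) τ =
      eC (-(m : ℂ) * (l : ℂ) ^ 2 * τ - 2 * (l : ℂ) * (m : ℂ) * x) * f x τ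

theorem eC_add_intCast (w : ℂ) (n : ℤ) : eC (w + n) = eC w := by
  rw [eC, eC, Complex.exp_eq_exp_iff_exists_int]
  exact ⟨n, by ring⟩

/-- Transformation under `x ↦ x + lτ + μ` of the term `f(ax, (aτ+b)/d)` of a Hecke transform. -/
theorem EllipticLaw.hecke_term {m : ℤ} {f : ℂ → ℂ → ℂ} (hf : EllipticLaw m f) {a d : ℕ}
    (ha : 0 < a) (hd : 0 < d) (b : ℕ) {τ : ℂ} (hτ : 0 < τ.im) (x : ℂ) (l μ : ℤ) :
    f (a * (x + l * τ + μ)) ((a * τ + b) / d) =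
      eC (-(m * (a * d)) * l ^ 2 * τ - 2 * l * (m * (a * d)) * x) *
        f (a * x) ((a * τ + b) / d) := by
  have hd' : (d : ℂ) ≠ 0 := by exact_mod_cast hd.ne'
  have him : 0 < (((a : ℂ) * τ + b) / d).im := by
    rw [Complex.div_natCast_im]
    have : 0 < (a : ℝ) * τ.im := by positivity
    have hd'' : (0 : ℝ) < d := by exact_mod_cast hd
    simpa using div_pos this hd''
  have key := hf (a * x) _ him (l * d) (a * μ - l * b)
  have hx : (a : ℂ) * x + ((l * d : ℤ) : ℂ) * ((a * τ + b) / d) + ((a * μ - l * b : ℤ) : ℂ) =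
      a * (x + l * τ + μ) := by
    push_cast
    field_simp
    ring
  have he : -(m : ℂ) * ((l * d : ℤ) : ℂ) ^ 2 * ((a * τ + b) / d)
        - 2 * ((l * d : ℤ) : ℂ) * m * (a * x) =
      (-(m * (a * d)) * l ^ 2 * τ - 2 * l * (m * (a * d)) * x)
        + ((-(m * l ^ 2 * d * b) : ℤ) : ℂ) := by
    push_cast
    field_simp
    ring
  rwa [hx, he, eC_add_intCast] at key

/-- If `f` satisfies the index-`m` elliptic transformation law, then its `ℓ`-th Hecke
transform of weight `k`,
`h(x,τ) = ℓ^{k-1} ∑_{a·d=ℓ} ∑_{b=0}^{d-1} d^{-k} f(ax, (aτ+b)/d)`,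
satisfies the index-`mℓ` elliptic transformation law. -/
theorem hecke_transform_ellipticLaw (k m : ℤ) (ℓ : ℕ) (hℓ : 0 < ℓ)
    (f : ℂ → ℂ → ℂ) (hf : EllipticLaw m f) :
    EllipticLaw (m * ℓ)
      (fun x τ =>
        (ℓ : ℂ) ^ (k - 1) *
          ∑ a ∈ ℓ.divisors, ∑ b ∈ Finset.range (ℓ / a),
            ((ℓ / a : ℕ) : ℂ) ^ (-k) *
              f ((a : ℂ) * x) (((a : ℂ) * τ + (b : ℂ)) / ((ℓ / a : ℕ) : ℂ))) := by
  intro x τ hτ l μ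
  simp only [Finset.mul_sum]
  refine Finset.sum_congr rfl fun a ha => Finset.sum_congr rfl fun b _ => ?_
  have hdvd := Nat.dvd_of_mem_divisors ha
  have hmul : (a : ℂ) * ((ℓ / a : ℕ) : ℂ) = ℓ := by
    exact_mod_cast Nat.mul_div_cancel' hdvd
  rw [hf.hecke_term (Nat.pos_of_mem_divisors ha) (Nat.div_pos (Nat.le_of_dvd hℓ hdvd)
    (Nat.pos_of_mem_divisors ha)) b hτ, hmul]
  push_cast
  ring
end
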